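/- The Coxeter group W(C) associated to a Coxeter matrix M = (m_{st}) is finite if and only if the symmetric matrix (−cos(π/m_{st}))_{s,t∈S} is positive-definite. -/

import Mathlib

open Real

variable {S : Type*} [Fintype S] [DecidableEq S]

/-- The linear map `α_t ↦ α_t − c_{st} α_s` on the real vector space with basis
`{α_s : s ∈ S}` (realised as `S → ℝ` with `α_s = Pi.single s 1`), determined by
a Cartan matrix `c`. -/
noncomputable def cartanRefl (c : S → S → ℝ) (s : S) : Module.End ℝ (S → ℝ) :=
  LinearMap.id - LinearMap.smulRight
    (∑ t, c s t • (LinearMap.proj t : (S → ℝ) →ₗ[ℝ] ℝ)) (Pi.single s 1)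

/-- The standard Cartan matrix `c_{st} = −2 cos(π / m_{st})` associated with a
Coxeter matrix (with `m_{st} = ∞` encoded by `M.M s t = 0`; note that in Lean
`π / 0 = 0`, so this correctly implements the convention `cos(π/∞) = 1`). -/
noncomputable def stdCartan (M : CoxeterMatrix S) : S → S → ℝ :=
  fun s t => -2 * Real.cos (π / (M.M s t : ℝ))

open CoxeterSystem
open Polynomial.Chebyshev (U U_add_two U_eval_one U_real_cos)

namespace CoxeterMatrix

/-- The matrix `(−cos(π / m_{st}))_{s,t}` of a Coxeter matrix. -/
noncomputable def gram (M : CoxeterMatrix S) : Matrix S S ℝ :=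
  Matrix.of fun s t : S => -Real.cos (π / (M.M s t : ℝ))

/-- The symmetric bilinear form of a Coxeter matrix. -/
noncomputable def form (M : CoxeterMatrix S) : LinearMap.BilinForm ℝ (S → ℝ) :=
  Matrix.toBilin' M.gram

/-- The simple reflections of the geometric representation. -/
noncomputable def simpleRefl (M : CoxeterMatrix S) (s : S) : Module.End ℝ (S → ℝ) :=
  cartanRefl (stdCartan M) s

theorem form_single_single (M : CoxeterMatrix S) (s t : S) :
    M.form (Pi.single s 1) (Pi.single t 1) = -Real.cos (π / (M.M s t : ℝ)) := by
  simp only [form, Matrix.toBilin'_single, gram, Matrix.of_apply]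

theorem form_single_self (M : CoxeterMatrix S) (s : S) :
    M.form (Pi.single s 1) (Pi.single s 1) = 1 := by
  rw [form_single_single, M.diagonal]
  simp

theorem form_comm (M : CoxeterMatrix S) (v w : S → ℝ) : M.form v w = M.form w v := by
  simp only [form, Matrix.toBilin'_apply]
  rw [Finset.sum_comm]
  refine Finset.sum_congr rfl fun i _ => Finset.sum_congr rfl fun j _ => ?_
  simp only [gram, Matrix.of_apply, M.symmetric i j]
  ring

theorem simpleRefl_apply (M : CoxeterMatrix S) (s : S) (v : S → ℝ) :
    M.simpleRefl s v = v - (2 * M.form (Pi.single s 1) v) • Pi.single s 1 := by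
  have h : M.form (Pi.single s 1) v = ∑ t, -Real.cos (π / (M.M s t : ℝ)) * v t := by
    rw [form, Matrix.toBilin'_apply', single_one_dotProduct]
    rfl
  simp only [simpleRefl, cartanRefl, stdCartan, LinearMap.sub_apply, LinearMap.id_apply,
    LinearMap.smulRight_apply, LinearMap.sum_apply, LinearMap.smul_apply, LinearMap.proj_apply,
    smul_eq_mul, h, Finset.mul_sum]
  congr 3
  ext t
  ring

theorem simpleRefl_single_self (M : CoxeterMatrix S) (s : S) :
    M.simpleRefl s (Pi.single s 1) = -Pi.single s 1 := by
  rw [simpleRefl_apply, form_single_self]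
  module

theorem simpleRefl_simpleRefl (M : CoxeterMatrix S) (s : S) (v : S → ℝ) :
    M.simpleRefl s (M.simpleRefl s v) = v := by
  rw [simpleRefl_apply M s v, map_sub, map_smul, simpleRefl_single_self, simpleRefl_apply]
  module

theorem form_simpleRefl (M : CoxeterMatrix S) (s : S) (v w : S → ℝ) :
    M.form (M.simpleRefl s v) (M.simpleRefl s w) = M.form v w := by
  simp only [simpleRefl_apply, map_sub, map_smul, LinearMap.sub_apply, LinearMap.smul_apply,
    form_single_self, smul_eq_mul, M.form_comm v (Pi.single s 1)]
  ring

theorem prod_alternatingWord_single (M : CoxeterMatrix S) (a b : S) (k : ℕ) :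
    ((alternatingWord a b k).map M.simpleRefl).prod (Pi.single a 1) =
      if Even k then
        (U ℝ k).eval (Real.cos (π / (M.M a b : ℝ))) • Pi.single a 1 +
          (U ℝ (k - 1)).eval (Real.cos (π / (M.M a b : ℝ))) • Pi.single b 1
      else
        (U ℝ (k - 1)).eval (Real.cos (π / (M.M a b : ℝ))) • Pi.single a 1 +
          (U ℝ k).eval (Real.cos (π / (M.M a b : ℝ))) • Pi.single b 1 := by
  induction k with
  | zero => simp [alternatingWord]
  | succ k ih =>
    have hU := congrArg (Polynomial.eval (Real.cos (π / (M.M a b : ℝ)))) (U_add_two ℝ ((k : ℤ) - 1))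
    rw [show (k : ℤ) - 1 + 2 = k + 1 by ring, show (k : ℤ) - 1 + 1 = k by ring] at hU
    simp only [Polynomial.eval_sub, Polynomial.eval_mul, Polynomial.eval_ofNat,
      Polynomial.eval_X] at hU
    rw [alternatingWord_succ', List.map_cons, List.prod_cons, Module.End.mul_apply, ih]
    push_cast
    rw [show (k : ℤ) + 1 - 1 = k by ring, hU]
    have hab := M.form_single_single a b
    have hba := (M.form_comm _ _).trans hab
    by_cases hk : Even k
    · simp only [hk, if_true, Nat.even_add_one, not_true, if_false, map_add, map_smul,
        simpleRefl_apply M b, form_single_self, hba]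
      module
    · simp only [hk, if_false, Nat.even_add_one, not_false_iff, if_true, map_add, map_smul,
        simpleRefl_apply M a, form_single_self, hab]
      module

theorem prod_alternatingWord_eq_pow (M : CoxeterMatrix S) (a b : S) (k : ℕ) :
    ((alternatingWord a b (2 * k)).map M.simpleRefl).prod =
      (M.simpleRefl a * M.simpleRefl b) ^ k := by
  induction k with
  | zero => simp [alternatingWord]
  | succ k ih =>
    rw [show 2 * (k + 1) = 2 * k + 1 + 1 by ring, alternatingWord_succ, alternatingWord_succ,
      pow_succ, ← ih]
    simp

theorem two_le_of_ne {B : Type*} (M : CoxeterMatrix B) {a b : B} (hab : a ≠ b) (h0 : M.M a b ≠ 0) :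
    2 ≤ M.M a b := by
  have := M.off_diagonal a b hab
  omega

theorem sin_pi_div_pos {m : ℕ} (hm : 2 ≤ m) : 0 < Real.sin (π / m) := by
  have h2 : (2 : ℝ) ≤ m := by exact_mod_cast hm
  apply Real.sin_pos_of_pos_of_lt_pi (by positivity)
  rw [div_lt_iff₀ (by positivity)]
  nlinarith [Real.pi_pos]

theorem eval_U_cos_pi_div_nonneg {m : ℕ} (hm : m ≠ 1) {k : ℤ} (hk : -1 ≤ k)
    (hkm : m ≠ 0 → k < m) : 0 ≤ (U ℝ k).eval (Real.cos (π / m)) := by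
  have hk' : (0 : ℝ) ≤ k + 1 := by exact_mod_cast (by linarith : (0 : ℤ) ≤ k + 1)
  rcases eq_or_ne m 0 with rfl | h0
  · simpa [U_eval_one] using hk'
  · have hs := sin_pi_div_pos (m := m) (by omega)
    refine nonneg_of_mul_nonneg_left ?_ hs
    rw [U_real_cos]
    have hm0 : (0 : ℝ) < m := by positivity
    have hkm' : (k : ℝ) + 1 ≤ m := by exact_mod_cast hkm h0
    apply Real.sin_nonneg_of_nonneg_of_le_pi (by positivity)
    rw [mul_div_assoc', div_le_iff₀ hm0]
    nlinarith [Real.pi_pos]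

theorem isLiftable_simpleRefl (M : CoxeterMatrix S) : M.IsLiftable M.simpleRefl := by
  intro a b
  rcases eq_or_ne a b with rfl | hab
  · rw [M.diagonal, pow_one]
    ext1 v
    ext1
    simp [simpleRefl_simpleRefl]
  rcases eq_or_ne (M.M a b) 0 with h0 | h0
  · rw [h0, pow_zero]
  obtain ⟨k, hk⟩ : ∃ k, M.M a b = k + 1 := Nat.exists_eq_succ_of_ne_zero h0
  have hs := sin_pi_div_pos (M.two_le_of_ne hab h0)
  have hm0 : (M.M a b : ℝ) ≠ 0 := by exact_mod_cast h0
  set c := Real.cos (π / (M.M a b : ℝ)) with hc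
  set m := M.M a b with hm
  have hmθ : (m : ℝ) * (π / m) = π := by field_simp
  have hU0 : (U ℝ (2 * m : ℤ)).eval c = 1 := by
    refine mul_right_cancel₀ hs.ne' ?_
    rw [hc, U_real_cos, one_mul]
    push_cast
    rw [show (2 * (m : ℝ) + 1) * (π / m) = π / m + 2 * (m * (π / m)) by ring, hmθ,
      Real.sin_add_two_pi]
  have hU1 : (U ℝ (2 * m - 1 : ℤ)).eval c = 0 := by
    refine mul_right_cancel₀ hs.ne' ?_
    rw [hc, U_real_cos, zero_mul]
    push_cast
    rw [show (2 * (m : ℝ) - 1 + 1) * (π / m) = 2 * (m * (π / m)) by ring, hmθ,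
      Real.sin_two_pi]
  have hU2 : (U ℝ (2 * m - 2 : ℤ)).eval c = -1 := by
    refine mul_right_cancel₀ hs.ne' ?_
    rw [hc, U_real_cos]
    push_cast
    rw [show (2 * (m : ℝ) - 2 + 1) * (π / m) = 2 * (m * (π / m)) - π / m by ring, hmθ,
      Real.sin_two_pi_sub]
    ring
  have ha : ((M.simpleRefl a * M.simpleRefl b) ^ m) (Pi.single a 1) = Pi.single a 1 := by
    rw [← prod_alternatingWord_eq_pow, prod_alternatingWord_single, if_pos (even_two_mul m)]
    push_cast
    rw [← hm, ← hc, hU0, hU1]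
    module
  have hb : ((M.simpleRefl a * M.simpleRefl b) ^ m) (Pi.single b 1) = Pi.single b 1 := by
    rw [← prod_alternatingWord_eq_pow, show 2 * m = 2 * k + 1 + 1 by omega, alternatingWord_succ,
      List.concat_eq_append, List.map_append, List.prod_append, Module.End.mul_apply,
      List.map_singleton, List.prod_singleton, simpleRefl_single_self, map_neg,
      prod_alternatingWord_single, if_neg (by simp), M.symmetric b a]
    change -((U ℝ (((2 * k + 1 : ℕ) : ℤ) - 1)).eval c • Pi.single b 1 +
      (U ℝ ((2 * k + 1 : ℕ) : ℤ)).eval c • Pi.single a 1) = _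
    rw [show ((2 * k + 1 : ℕ) : ℤ) - 1 = 2 * m - 2 by rw [hk]; push_cast; ring,
      show ((2 * k + 1 : ℕ) : ℤ) = 2 * m - 1 by rw [hk]; push_cast; ring, hU1, hU2]
    module
  have hfix : ∀ (n : ℕ) (z : S → ℝ), M.form (Pi.single a 1) z = 0 →
      M.form (Pi.single b 1) z = 0 → ((M.simpleRefl a * M.simpleRefl b) ^ n) z = z := by
    intro n z hza hzb
    induction n with
    | zero => simp
    | succ n ih =>
      rw [pow_succ, Module.End.mul_apply, Module.End.mul_apply, simpleRefl_apply M b, hzb]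
      simp only [mul_zero, zero_smul, sub_zero]
      rw [simpleRefl_apply M a, hza]
      simpa using ih
  have hdet : 1 - c ^ 2 ≠ 0 := by
    rw [hc, ← Real.sin_sq]
    positivity
  refine LinearMap.ext fun z => ?_
  set p := M.form (Pi.single a 1) z
  set q := M.form (Pi.single b 1) z
  have hfab := M.form_single_single a b
  have hfba := (M.form_comm _ _).trans hfab
  rw [← hm, ← hc] at hfab hfba
  set x := (p + c * q) / (1 - c ^ 2)
  set y := (q + c * p) / (1 - c ^ 2)
  have hz := hfix m (z - x • Pi.single a 1 - y • Pi.single b 1)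
    (by
      simp only [map_sub, map_smul, form_single_self, hfab, smul_eq_mul]
      simp only [x, y]
      change p - _ - _ = 0
      field_simp
      ring)
    (by
      simp only [map_sub, map_smul, form_single_self, hfba, smul_eq_mul]
      simp only [x, y]
      change q - _ - _ = 0
      field_simp
      ring)
  rw [map_sub, map_sub, map_smul, map_smul, ha, hb] at hz
  simpa using hz

/-- The geometric representation of the abstract Coxeter group. -/
noncomputable def geomRep (M : CoxeterMatrix S) : M.Group →* Module.End ℝ (S → ℝ) :=
  M.toCoxeterSystem.lift ⟨M.simpleRefl, M.isLiftable_simpleRefl⟩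

theorem geomRep_simple (M : CoxeterMatrix S) (s : S) :
    M.geomRep (M.toCoxeterSystem.simple s) = M.simpleRefl s :=
  M.toCoxeterSystem.lift_apply_simple M.isLiftable_simpleRefl s

theorem geomRep_wordProd (M : CoxeterMatrix S) (ω : List S) :
    M.geomRep (M.toCoxeterSystem.wordProd ω) = (ω.map M.simpleRefl).prod := by
  rw [wordProd, map_list_prod, List.map_map]
  rfl

theorem form_geomRep (M : CoxeterMatrix S) (g : M.Group) (v w : S → ℝ) :
    M.form (M.geomRep g v) (M.geomRep g w) = M.form v w := by
  induction g using M.toCoxeterSystem.simple_induction_left generalizing v w with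
  | one => simp
  | mul_simple_left g s ih =>
    simp only [map_mul, geomRep_simple, Module.End.mul_apply, form_simpleRefl, ih]

/-- Every element has a factorisation `w = v * u` with additive lengths such that `u` is an
alternating word in `a` and `b` that cannot be extended on the left. -/
theorem exists_maximal_alternating_tail {B W : Type*} [Group W] {M : CoxeterMatrix B}
    (cs : CoxeterSystem M W) (w : W) (a b : B) :
    ∃ (k : ℕ) (v : W), w = v * cs.wordProd (alternatingWord a b k) ∧
      cs.length w = cs.length v + k ∧
      ¬ cs.IsRightDescent v (if Even k then b else a) := by
  let P : ℕ → Prop := fun k => ∃ v : W, w = v * cs.wordProd (alternatingWord a b k) ∧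
      cs.length w = cs.length v + k
  classical
  have hP0 : P 0 := ⟨w, by simp [alternatingWord]⟩
  obtain ⟨v, hv, hl⟩ := Nat.findGreatest_spec (P := P) (Nat.zero_le (cs.length w)) hP0
  refine ⟨_, v, hv, hl, fun hd => ?_⟩
  set k := Nat.findGreatest P (cs.length w)
  set x := if Even k then b else a with hx
  rw [cs.isRightDescent_iff] at hd
  refine Nat.findGreatest_is_greatest (P := P) (n := cs.length w) (k := k + 1) (Nat.lt_succ_self k)
    (by omega) ⟨v * cs.simple x, ?_, by omega⟩
  rw [alternatingWord_succ', ← hx, wordProd_cons, ← mul_assoc, cs.simple_mul_simple_cancel_right]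
  exact hv

theorem geomRep_single_nonneg (M : CoxeterMatrix S) (w : M.Group) (s : S)
    (hs : ¬ M.toCoxeterSystem.IsRightDescent w s) (i : S) :
    0 ≤ M.geomRep w (Pi.single s 1) i := by
  induction hn : M.toCoxeterSystem.length w using Nat.strong_induction_on generalizing w s with
  | _ n ih =>
  subst hn
  set cs := M.toCoxeterSystem with hcs
  rcases eq_or_ne w 1 with rfl | hw
  · rw [map_one, Module.End.one_apply]
    exact (Pi.single_nonneg.2 zero_le_one : (0 : S → ℝ) ≤ _) i
  obtain ⟨t, ht⟩ := cs.exists_rightDescent_of_ne_one hw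
  have hst : s ≠ t := by rintro rfl; exact hs ht
  obtain ⟨k, v, hwv, hl, hv⟩ := exists_maximal_alternating_tail cs w s t
  obtain ⟨j, rfl⟩ : ∃ j, k = j + 1 := by
    refine Nat.exists_eq_succ_of_ne_zero ?_
    rintro rfl
    simp only [alternatingWord, wordProd_nil, mul_one] at hwv
    subst hwv
    simp only [Even.zero, if_true] at hv
    exact hv ht
  have hv' : ¬ cs.IsRightDescent v (if Even j then t else s) := by
    intro hd
    rw [cs.isRightDescent_iff] at hd
    rw [alternatingWord_succ', wordProd_cons, ← mul_assoc] at hwv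
    have h1 := cs.length_mul_le (v * cs.simple (if Even j then t else s))
      (cs.wordProd (alternatingWord s t j))
    have h2 := cs.length_wordProd_le (alternatingWord s t j)
    rw [length_alternatingWord] at h2
    rw [← hwv] at h1
    omega
  have hvs : ¬ cs.IsRightDescent v s ∧ ¬ cs.IsRightDescent v t := by
    by_cases hj : Even j
    · simp only [hj, Nat.even_add_one, not_true, if_true, if_false] at hv hv'
      exact ⟨hv, hv'⟩
    · simp only [hj, Nat.even_add_one, not_false_iff, if_true, if_false] at hv hv'
      exact ⟨hv', hv⟩
  have hps := ih _ (by omega) v s hvs.1 rfl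
  have hpt := ih _ (by omega) v t hvs.2 rfl
  have hkm : M.M s t ≠ 0 → ((j + 1 : ℕ) : ℤ) < M.M s t := by
    intro h0
    by_contra! hle
    have hle' : M.M s t ≤ j + 1 := by exact_mod_cast hle
    have hr := cs.not_isReduced_alternatingWord t s (m := j + 1 + 1)
      (by rwa [M.symmetric]) (by rw [M.symmetric]; omega)
    rw [CoxeterSystem.IsReduced, length_alternatingWord] at hr
    have h2 := cs.length_wordProd_le (alternatingWord t s (j + 1 + 1))
    rw [length_alternatingWord] at h2
    have h3 := cs.length_mul_le v (cs.wordProd (alternatingWord t s (j + 1 + 1)))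
    rw [alternatingWord_succ t s (j + 1), wordProd_concat, ← mul_assoc, ← hwv,
      ← wordProd_concat, ← alternatingWord_succ] at h3
    rw [cs.not_isRightDescent_iff] at hs
    omega
  have hm1 := M.off_diagonal s t hst
  have h1 := eval_U_cos_pi_div_nonneg hm1 (k := ((j + 1 : ℕ) : ℤ)) (by omega) hkm
  have h2 := eval_U_cos_pi_div_nonneg hm1 (k := ((j + 1 : ℕ) : ℤ) - 1) (by omega)
    (fun h => by have := hkm h; omega)
  rw [hwv, map_mul, Module.End.mul_apply, geomRep_wordProd, prod_alternatingWord_single]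
  split_ifs
  all_goals
    simp only [map_add, map_smul, Pi.add_apply, Pi.smul_apply, smul_eq_mul]
    positivity

theorem exists_geomRep_single_nonpos (M : CoxeterMatrix S) {w : M.Group} (hw : w ≠ 1) :
    ∃ s, ∀ i, M.geomRep w (Pi.single s 1) i ≤ 0 := by
  obtain ⟨s, hs⟩ := M.toCoxeterSystem.exists_rightDescent_of_ne_one hw
  refine ⟨s, fun i => ?_⟩
  have h := M.geomRep_single_nonneg _ s
    (M.toCoxeterSystem.isRightDescent_iff_not_isRightDescent_mul.1 hs) i
  rw [map_mul, Module.End.mul_apply, geomRep_simple, simpleRefl_single_self, map_neg,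
    Pi.neg_apply] at h
  linarith

end CoxeterMatrix

theorem finite_of_norm_le_of_one_le_dist {ι E : Type*} [NormedAddCommGroup E] [ProperSpace E]
    (y : ι → E) (r : ℝ) (hr : ∀ i, ‖y i‖ ≤ r) (hd : Pairwise fun i j => 1 ≤ dist (y i) (y j)) :
    Finite ι := by
  by_contra hι
  rw [not_finite_iff_infinite] at hι
  let f := Infinite.natEmbedding ι
  obtain ⟨a, -, φ, hφ, hlim⟩ := tendsto_subseq_of_bounded
    (Metric.isBounded_closedBall (x := (0 : E)) (r := r)) (x := fun n => y (f n))
    (fun n => by simpa using hr (f n))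
  obtain ⟨N, hN⟩ := Metric.cauchySeq_iff.1 hlim.cauchySeq 1 one_pos
  have h := hN (N + 1) (by omega) N le_rfl
  exact absurd (hd (f.injective.ne (hφ.injective.ne (Nat.succ_ne_self N)))) (not_le.2 h)

theorem LinearMap.BilinForm.finite_of_separated {ι V : Type*} [AddCommGroup V] [Module ℝ V]
    [FiniteDimensional ℝ V] (β : LinearMap.BilinForm ℝ V) (hsymm : ∀ v w, β v w = β w v)
    (hpos : ∀ v, v ≠ 0 → 0 < β v v) (y : ι → V) (r : ℝ) (hr : ∀ i, β (y i) (y i) ≤ r)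
    (hd : Pairwise fun i j => 1 ≤ β (y i - y j) (y i - y j)) : Finite ι := by
  let core : InnerProductSpace.Core ℝ V :=
    { inner := fun v w => β v w
      conj_inner_symm := fun v w => hsymm w v
      re_inner_nonneg := fun v => by
        rcases eq_or_ne v 0 with rfl | hv
        · simp
        · exact (hpos v hv).le
      add_left := fun u v w => by simp
      smul_left := fun v w c => by simp
      definite := fun v hv => by
        by_contra h
        exact (hpos v h).ne' hv }
  let : NormedAddCommGroup V := core.toNormedAddCommGroup
  let : InnerProductSpace ℝ V := InnerProductSpace.ofCore core.toCore
  have : ProperSpace V := FiniteDimensional.proper ℝ V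
  have hn (v : V) : ‖v‖ ^ 2 = β v v := (real_inner_self_eq_norm_sq v).symm
  refine finite_of_norm_le_of_one_le_dist y (Real.sqrt r) (fun i => ?_) fun i j hij => ?_
  · exact Real.le_sqrt_of_sq_le ((hn _).trans_le (hr i))
  · change 1 ≤ dist (y i) (y j)
    rw [dist_eq_norm, ← one_le_sq_iff₀ (norm_nonneg _), hn]
    exact hd hij

namespace CoxeterMatrix

theorem finite_group_of_posDef (M : CoxeterMatrix S) (hG : M.gram.PosDef) : Finite M.Group := by
  have hu : IsUnit M.gram := hG.isUnit
  obtain ⟨x, hx⟩ := (Matrix.mulVec_surjective_iff_isUnit.2 hu) 1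
  have hxv (v : S → ℝ) : M.form v x = ∑ i, v i := by
    rw [form, Matrix.toBilin'_apply', hx, dotProduct_one]
  have hpos (v : S → ℝ) (hv : v ≠ 0) : 0 < M.form v v := by
    rw [form, Matrix.toBilin'_apply']
    exact (Matrix.posDef_iff_dotProduct_mulVec.1 hG).2 hv
  refine M.form.finite_of_separated M.form_comm hpos (fun g => M.geomRep g x) (M.form x x)
    (fun g => (M.form_geomRep g x x).le) fun g h hgh => ?_
  change 1 ≤ M.form (M.geomRep g x - M.geomRep h x) (M.geomRep g x - M.geomRep h x)
  obtain ⟨s, hs⟩ := M.exists_geomRep_single_nonpos (w := g⁻¹ * h) (by simpa [inv_mul_eq_one] using hgh)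
  set d := M.geomRep g x - M.geomRep h x with hd_def
  set u := M.geomRep h (Pi.single s 1) with hu_def
  have huu : M.form u u = 1 := by rw [hu_def, form_geomRep, form_single_self]
  have h1 : M.form u (M.geomRep h x) = 1 := by
    rw [hu_def, form_geomRep, hxv]
    simp
  have h2 : M.form u (M.geomRep g x) ≤ 0 := by
    have : u = M.geomRep g (M.geomRep (g⁻¹ * h) (Pi.single s 1)) := by
      rw [← Module.End.mul_apply, ← map_mul, mul_inv_cancel_left]
    rw [this, form_geomRep, hxv]
    exact Finset.sum_nonpos fun i _ => hs i
  have h3 : M.form u d ≤ -1 := by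
    rw [hd_def, map_sub, h1]
    linarith
  have h4 : 0 ≤ M.form (d + u) (d + u) := by
    rcases eq_or_ne (d + u) 0 with h0 | h0
    · simp [h0]
    · exact (hpos _ h0).le
  simp only [map_add, LinearMap.add_apply, huu, M.form_comm d u] at h4
  linarith

theorem finite_closure_of_posDef (M : CoxeterMatrix S) (hG : M.gram.PosDef) :
    Finite (Submonoid.closure (Set.range M.simpleRefl)) := by
  have := M.finite_group_of_posDef hG
  have hle : Submonoid.closure (Set.range M.simpleRefl) ≤ MonoidHom.mrange M.geomRep := by
    rw [Submonoid.closure_le]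
    rintro _ ⟨s, rfl⟩
    exact ⟨_, M.geomRep_simple s⟩
  exact Set.Finite.subset (Set.finite_range M.geomRep) hle

/-- The sum of the translates of the standard inner product under a finite group of reflections
is invariant under these reflections. -/
theorem exists_invariant_form (M : CoxeterMatrix S)
    (hfin : Finite (Submonoid.closure (Set.range M.simpleRefl))) :
    ∃ β : LinearMap.BilinForm ℝ (S → ℝ), (∀ v w, β v w = β w v) ∧ (∀ v, v ≠ 0 → 0 < β v v) ∧
      ∀ s v w, β (M.simpleRefl s v) (M.simpleRefl s w) = β v w := by
  set N := Submonoid.closure (Set.range M.simpleRefl)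
  have := Fintype.ofFinite N
  let δ : LinearMap.BilinForm ℝ (S → ℝ) := Matrix.toBilin' (1 : Matrix S S ℝ)
  have hδ (v w) : δ v w = v ⬝ᵥ w := by simp [δ, Matrix.toBilin'_apply']
  let β : LinearMap.BilinForm ℝ (S → ℝ) := ∑ g : N, δ.comp g.1 g.1
  have hβ (v w) : β v w = ∑ g : N, (g.1 v) ⬝ᵥ (g.1 w) := by
    simp [β, LinearMap.sum_apply, hδ]
  refine ⟨β, fun v w => ?_, fun v hv => ?_, fun s v w => ?_⟩
  · simp only [hβ, dotProduct_comm]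
  · rw [hβ]
    refine Finset.sum_pos' (fun g _ => ?_) ⟨1, Finset.mem_univ _, ?_⟩
    · simpa using dotProduct_star_self_nonneg (g.1 v)
    · simpa using (Matrix.dotProduct_star_self_pos_iff (v := v)).2 hv
  · have hs2 : M.simpleRefl s * M.simpleRefl s = 1 :=
      LinearMap.ext fun v => M.simpleRefl_simpleRefl s v
    let σ : N := ⟨M.simpleRefl s, Submonoid.subset_closure ⟨s, rfl⟩⟩
    have hσ : σ * σ = 1 := Subtype.ext hs2
    let e : N ≃ N := ⟨(· * σ), (· * σ), fun g => by simp [mul_assoc, hσ],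
      fun g => by simp [mul_assoc, hσ]⟩
    rw [hβ, hβ, ← e.sum_comp fun g : N => g.1 v ⬝ᵥ g.1 w]
    rfl

theorem posDef_of_finite_closure (M : CoxeterMatrix S)
    (hfin : Finite (Submonoid.closure (Set.range M.simpleRefl))) : M.gram.PosDef := by
  obtain ⟨β, hsymm, hpos, hinv⟩ := M.exists_invariant_form hfin
  let d : S → ℝ := fun s => β (Pi.single s 1) (Pi.single s 1)
  have hd (s) : 0 < d s := hpos _ (by simp)
  have hform (s) (v) : d s * M.form (Pi.single s 1) v = β (Pi.single s 1) v := by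
    have h := hinv s (Pi.single s 1) v
    rw [simpleRefl_single_self, simpleRefl_apply] at h
    simp only [map_sub, map_smul, map_neg, LinearMap.neg_apply, smul_eq_mul] at h
    simp only [d]
    linarith
  have hgram (s t) : M.gram s t = β (Pi.single s 1) (Pi.single t 1) / (√(d s) * √(d t)) := by
    have hst := hform s (Pi.single t 1)
    have hts := hform t (Pi.single s 1)
    rw [hsymm, M.form_comm, ← hst] at hts
    have hg : M.gram s t = M.form (Pi.single s 1) (Pi.single t 1) := by
      rw [form, Matrix.toBilin'_single]
    have hsq := Real.mul_self_sqrt (hd s).le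
    have := Real.sqrt_pos.2 (hd s)
    have := Real.sqrt_pos.2 (hd t)
    rw [eq_div_iff (by positivity), ← hst, hg]
    rcases eq_or_ne (M.form (Pi.single s 1) (Pi.single t 1)) 0 with h0 | h0
    · simp [h0]
    · rw [mul_right_cancel₀ h0 hts, hsq, mul_comm]
  refine Matrix.posDef_iff_dotProduct_mulVec.2 ⟨?_, fun x hx => ?_⟩
  · ext s t
    simp [gram, M.symmetric s t]
  · let y : S → ℝ := fun s => x s / √(d s)
    have hy : y ≠ 0 := by
      contrapose! hx
      ext s
      have h := congrFun hx s
      simpa [y, (Real.sqrt_pos.2 (hd s)).ne'] using h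
    have hyy : β y y = star x ⬝ᵥ (M.gram.mulVec x) := by
      have hβ : β = Matrix.toBilin' (LinearMap.BilinForm.toMatrix' β) := by simp
      rw [hβ, Matrix.toBilin'_apply]
      simp only [dotProduct, Matrix.mulVec, Finset.mul_sum, hgram, star_trivial,
        LinearMap.BilinForm.toMatrix'_apply, y]
      refine Finset.sum_congr rfl fun i _ => Finset.sum_congr rfl fun j _ => ?_
      field_simp
    exact hyy ▸ hpos y hy

end CoxeterMatrix

/-- The group `W(C)` generated by the reflections associated to the standard
Cartan matrix of the Coxeter matrix `M` is finite if and only if the symmetric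
matrix `(−cos(π / m_{st}))_{s,t}` is positive-definite. -/
theorem coxeter_finite_iff_posDef (M : CoxeterMatrix S) :
    Finite ↥(Submonoid.closure (Set.range (cartanRefl (stdCartan M)))) ↔
      Matrix.PosDef (Matrix.of fun s t : S => -Real.cos (π / (M.M s t : ℝ))) := by
  exact ⟨M.posDef_of_finite_closure, M.finite_closure_of_posDef⟩
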